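/- arXiv:1912.09570 — 10 statements merged into one kernel-verified Lean document; each statement's English description precedes it below -/
import Mathlib

section
/- Let E be a real normed vector space, F : E → E a vector field, λ ∈ ℂ, and φ : E → ℂ a differentiable function satisfying the Koopman generator PDE fderiv ℝ φ x (F x) = λ · φ(x) for every x ∈ E. If γ : ℝ → E is a solution curve of the ODE, i.e. γ has derivative F(γ t) at every t ∈ ℝ (HasDerivAt γ (F (γ t)) t), then the eigenfunction evolves linearly along the orbit: φ(γ t) = exp(λ·t) · φ(γ 0) for every t ∈ ℝ. -/
/-- An eigenfunction of the Koopman generator evolves linearly along orbits: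
if `fderiv ℝ φ x (F x) = λ φ(x)` everywhere and `γ` solves `ẋ = F(x)`, then
`φ(γ t) = e^{λ t} φ(γ 0)`. -/
theorem koopman_generator_pde_implies_linear_evolution
    {E : Type*} [NormedAddCommGroup E] [NormedSpace ℝ E]
    (F : E → E) (lam : ℂ) (φ : E → ℂ)
    (hφ : Differentiable ℝ φ)
    (hpde : ∀ x : E, fderiv ℝ φ x (F x) = lam * φ x)
    (γ : ℝ → E)
    (hγ : ∀ t : ℝ, HasDerivAt γ (F (γ t)) t) :
    ∀ t : ℝ, φ (γ t) = Complex.exp (lam * t) * φ (γ 0) := by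
  intro t
  have hcomp : ∀ s : ℝ, HasDerivAt (fun u => φ (γ u)) (lam * φ (γ s)) s := fun s => by
    simpa only [hpde, Function.comp_def] using
      (hφ (γ s)).hasFDerivAt.comp_hasDerivAt s (hγ s)
  have hexp : ∀ s : ℝ, HasDerivAt (fun u : ℝ => Complex.exp (-(lam * u)))
      (Complex.exp (-(lam * s)) * -(lam * 1)) s := fun s =>
    (((Complex.ofRealCLM.hasDerivAt (x := s)).const_mul lam).neg).cexp
  have hprod : ∀ s : ℝ,
      HasDerivAt (fun u : ℝ => Complex.exp (-(lam * u)) * φ (γ u)) 0 s := fun s =>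
    ((hexp s).mul (hcomp s)).congr_deriv (by ring)
  have hconst : Complex.exp (-(lam * t)) * φ (γ t) = φ (γ 0) := by
    simpa using is_const_of_deriv_eq_zero (fun s => (hprod s).differentiableAt)
      (fun s => (hprod s).deriv) t 0
  rw [← hconst, ← mul_assoc, ← Complex.exp_add, add_neg_cancel, Complex.exp_zero, one_mul]
end

section
/- Let E be a real normed vector space, F : E → E a vector field, λ ∈ ℂ, and x ∈ E. Suppose ψ : E → ℂ is differentiable at x with fderiv ℝ ψ x (F x) = 0 (ψ is a first integral, constant along the flow of F), and r : E → ℝ is differentiable at x with fderiv ℝ r x (F x) = 1 (r is a time-like function along the flow). Then the function φ : E → ℂ defined by φ(y) = ψ(y) · exp(λ · r(y)) is differentiable at x and satisfies the Koopman generator PDE at x: fderiv ℝ φ x (F x) = λ · φ(x). -/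
/-- If `ψ` is a first integral (`F·∇ψ = 0` at `x`) and `r` is a time-like
function (`F·∇r = 1` at `x`), then `φ(y) = ψ(y) e^{λ r(y)}` satisfies the
Koopman generator PDE `F(x)·∇φ(x) = λ φ(x)` at `x`. -/
theorem characteristics_solution_satisfies_generator_pde
    {E : Type*} [NormedAddCommGroup E] [NormedSpace ℝ E]
    (F : E → E) (lam : ℂ) (x : E)
    (ψ : E → ℂ) (hψ : DifferentiableAt ℝ ψ x)
    (hψpde : fderiv ℝ ψ x (F x) = 0)
    (r : E → ℝ) (hr : DifferentiableAt ℝ r x)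
    (hrpde : fderiv ℝ r x (F x) = 1) :
    DifferentiableAt ℝ (fun y => ψ y * Complex.exp (lam * (r y : ℂ))) x ∧
      fderiv ℝ (fun y => ψ y * Complex.exp (lam * (r y : ℂ))) x (F x) =
        lam * (ψ x * Complex.exp (lam * (r x : ℂ))) := by
  have hexp := ((Complex.ofRealCLM.hasFDerivAt.comp x hr.hasFDerivAt).const_mul lam).cexp
  have hφ := hψ.hasFDerivAt.mul hexp
  refine ⟨hφ.differentiableAt, ?_⟩
  refine (DFunLike.congr_fun hφ.fderiv (F x)).trans ?_
  simp [hψpde, hrpde]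
  ring
end

section
/- Let E be a real normed vector space, F : E → E a vector field, λ₁, λ₂ ∈ ℝ, α₁, α₂ ∈ ℝ with 0 < α₁ and 0 < α₂, and x ∈ E. Suppose φ₁, φ₂ : E → ℝ are differentiable at x, satisfy φ₁(x) > 0 and φ₂(x) > 0, and satisfy the Koopman generator PDE at x: fderiv ℝ φ₁ x (F x) = λ₁ · φ₁(x) and fderiv ℝ φ₂ x (F x) = λ₂ · φ₂(x). Then the function g : E → ℝ defined by g(y) = (φ₁ y)^{α₁} · (φ₂ y)^{α₂} (real powers, Real.rpow) is differentiable at x and satisfies fderiv ℝ g x (F x) = (α₁·λ₁ + α₂·λ₂) · g(x). -/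
/-- Algebraic semigroup property of KEIGS (real powers): if `(λ₁, φ₁)` and
`(λ₂, φ₂)` satisfy the generator PDE at `x` with `φᵢ(x) > 0`, then
`φ₁^{α₁} φ₂^{α₂}` satisfies the PDE at `x` with eigenvalue `α₁λ₁ + α₂λ₂`. -/
theorem keigs_algebraic_property_rpow
    {E : Type*} [NormedAddCommGroup E] [NormedSpace ℝ E]
    (F : E → E) (lam₁ lam₂ α₁ α₂ : ℝ) (hα₁ : 0 < α₁) (hα₂ : 0 < α₂) (x : E)
    (φ₁ φ₂ : E → ℝ)
    (hφ₁ : DifferentiableAt ℝ φ₁ x) (hφ₂ : DifferentiableAt ℝ φ₂ x)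
    (hpos₁ : 0 < φ₁ x) (hpos₂ : 0 < φ₂ x)
    (hpde₁ : fderiv ℝ φ₁ x (F x) = lam₁ * φ₁ x)
    (hpde₂ : fderiv ℝ φ₂ x (F x) = lam₂ * φ₂ x) :
    DifferentiableAt ℝ (fun y => (φ₁ y) ^ α₁ * (φ₂ y) ^ α₂) x ∧
      fderiv ℝ (fun y => (φ₁ y) ^ α₁ * (φ₂ y) ^ α₂) x (F x) =
        (α₁ * lam₁ + α₂ * lam₂) * ((φ₁ x) ^ α₁ * (φ₂ x) ^ α₂) := by
  have h := (hφ₁.hasFDerivAt.rpow_const (p := α₁) (Or.inl hpos₁.ne')).fun_mul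
    (hφ₂.hasFDerivAt.rpow_const (p := α₂) (Or.inl hpos₂.ne'))
  refine ⟨h.differentiableAt, ?_⟩
  rw [h.fderiv]
  simp only [add_apply, smul_apply, smul_eq_mul, hpde₁, hpde₂,
    Real.rpow_sub_one hpos₁.ne', Real.rpow_sub_one hpos₂.ne']
  field_simp
  ring
end

section
/- Let E be a real normed vector space, F : E → E a vector field, λ₁, λ₂ ∈ ℂ, n, m ∈ ℕ, and x ∈ E. Suppose φ₁, φ₂ : E → ℂ are differentiable at x and satisfy the Koopman generator PDE at x: fderiv ℝ φ₁ x (F x) = λ₁ · φ₁(x) and fderiv ℝ φ₂ x (F x) = λ₂ · φ₂(x). Then the product of powers g(y) = (φ₁ y)^n · (φ₂ y)^m is differentiable at x and satisfies fderiv ℝ g x (F x) = (n·λ₁ + m·λ₂) · (φ₁ x)^n · (φ₂ x)^m. In particular, taking φ₁ = φ₂ and m = 0, integer powers of an eigenfunction are eigenfunctions with eigenvalue multiplied by the exponent. -/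
/-- A power of a solution of the generator PDE solves it with eigenvalue multiplied by the
exponent. -/
theorem fderiv_pow_apply_of_eigen
    {E : Type*} [NormedAddCommGroup E] [NormedSpace ℝ E] {φ : E → ℂ} {x v : E} {c : ℂ}
    (hφ : DifferentiableAt ℝ φ x) (h : fderiv ℝ φ x v = c * φ x) (n : ℕ) :
    fderiv ℝ (fun y => φ y ^ n) x v = n * c * φ x ^ n := by
  rw [fderiv_fun_pow n hφ]
  cases n with
  | zero => simp
  | succ k =>
    simp only [add_tsub_cancel_right, smul_apply, h, smul_eq_mul,
      nsmul_eq_mul]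
    ring

/-- Algebraic property of KEIGS, complex-valued, natural-number powers:
if `(λ₁, φ₁)` and `(λ₂, φ₂)` satisfy the generator PDE at `x`, then
`φ₁^n φ₂^m` satisfies it with eigenvalue `n λ₁ + m λ₂`. -/
theorem keigs_algebraic_property_pow
    {E : Type*} [NormedAddCommGroup E] [NormedSpace ℝ E]
    (F : E → E) (lam₁ lam₂ : ℂ) (n m : ℕ) (x : E)
    (φ₁ φ₂ : E → ℂ)
    (hφ₁ : DifferentiableAt ℝ φ₁ x) (hφ₂ : DifferentiableAt ℝ φ₂ x)
    (hpde₁ : fderiv ℝ φ₁ x (F x) = lam₁ * φ₁ x)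
    (hpde₂ : fderiv ℝ φ₂ x (F x) = lam₂ * φ₂ x) :
    DifferentiableAt ℝ (fun y => (φ₁ y) ^ n * (φ₂ y) ^ m) x ∧
      fderiv ℝ (fun y => (φ₁ y) ^ n * (φ₂ y) ^ m) x (F x) =
        ((n : ℂ) * lam₁ + (m : ℂ) * lam₂) * (φ₁ x) ^ n * (φ₂ x) ^ m := by
  refine ⟨(hφ₁.pow n).mul (hφ₂.pow m), ?_⟩
  rw [fderiv_fun_mul (hφ₁.fun_pow n) (hφ₂.fun_pow m)]
  simp only [add_apply, smul_apply, smul_eq_mul,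
    fderiv_pow_apply_of_eigen hφ₁ hpde₁, fderiv_pow_apply_of_eigen hφ₂ hpde₂]
  ring
end

section
/- Let E be a real normed vector space and F : E → E a vector field. Suppose there exists λ ∈ ℝ and a function φ : E → ℝ that is differentiable at every point, strictly positive everywhere, satisfies the Koopman generator PDE fderiv ℝ φ x (F x) = λ · φ(x) for every x ∈ E, and is nonconstant (there exist a, b ∈ E with φ(a) ≠ φ(b)). Then: (i) the map from ℝ to functions E → ℝ sending p to (x ↦ (φ x)^p) (Real.rpow) is injective; (ii) each function x ↦ (φ x)^p is everywhere differentiable and satisfies the PDE with eigenvalue p·λ; and consequently (iii) the set { g : E → ℝ | g is everywhere differentiable and there exists μ ∈ ℝ such that fderiv ℝ g x (F x) = μ · g(x) for all x } is not countable. -/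
/-- Corollary 3: from a single positive nonconstant eigenfunction, the family
of real powers gives injectively-many eigenfunctions, hence the set of
Koopman generator eigenfunctions is uncountable. -/
theorem keigs_uncountable
    {E : Type*} [NormedAddCommGroup E] [NormedSpace ℝ E]
    (F : E → E) (lam : ℝ) (φ : E → ℝ)
    (hφ : ∀ x : E, DifferentiableAt ℝ φ x)
    (hpos : ∀ x : E, 0 < φ x)
    (hpde : ∀ x : E, fderiv ℝ φ x (F x) = lam * φ x)
    (hnc : ∃ a b : E, φ a ≠ φ b) :
    Function.Injective (fun p : ℝ => (fun x : E => (φ x) ^ p)) ∧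
      (∀ p : ℝ, (∀ x : E, DifferentiableAt ℝ (fun y : E => (φ y) ^ p) x) ∧
        (∀ x : E, fderiv ℝ (fun y : E => (φ y) ^ p) x (F x) = (p * lam) * (φ x) ^ p)) ∧
      ¬ Set.Countable { g : E → ℝ | (∀ x : E, DifferentiableAt ℝ g x) ∧
          ∃ μ : ℝ, ∀ x : E, fderiv ℝ g x (F x) = μ * g x } := by
  have hinj : Function.Injective (fun p : ℝ => (fun x : E => (φ x) ^ p)) := by
    obtain ⟨c, hc⟩ : ∃ c, φ c ≠ 1 := by
      by_contra! h
      obtain ⟨a, b, hab⟩ := hnc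
      exact hab ((h a).trans (h b).symm)
    intro p q hpq
    have h : Real.log (φ c ^ p) = Real.log (φ c ^ q) := congrArg Real.log (congrFun hpq c)
    rw [Real.log_rpow (hpos c), Real.log_rpow (hpos c)] at h
    exact mul_right_cancel₀ (Real.log_ne_zero_of_pos_of_ne_one (hpos c) hc) h
  have hpow : ∀ p : ℝ, (∀ x : E, DifferentiableAt ℝ (fun y : E => (φ y) ^ p) x) ∧
      (∀ x : E, fderiv ℝ (fun y : E => (φ y) ^ p) x (F x) = (p * lam) * (φ x) ^ p) := by
    intro p
    have hd (x : E) := (hφ x).hasFDerivAt.rpow_const (p := p) (Or.inl (hpos x).ne')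
    refine ⟨fun x => (hd x).differentiableAt, fun x => ?_⟩
    rw [(hd x).fderiv, _root_.smul_apply, hpde, smul_eq_mul,
      Real.rpow_sub_one (hpos x).ne']
    have := (hpos x).ne'
    field_simp
  refine ⟨hinj, hpow, fun hcount => ?_⟩
  refine Cardinal.not_countable_real ((hcount.preimage hinj).mono fun p _ => ?_)
  exact ⟨(hpow p).1, p * lam, (hpow p).2⟩
end

section
/- Let r, s : ℝ × ℝ → ℝ be differentiable at a point x ∈ ℝ × ℝ, let h, h̃ : ℝ → ℝ be differentiable at the point s(x), and let λ ∈ ℝ. Define φ(y) = h(s y) · exp(λ · r y) and φ̃(y) = h̃(s y) · exp(λ · r y). Writing ∂₁f = fderiv ℝ f x (1,0) and ∂₂f = fderiv ℝ f x (0,1) for partial derivatives at x, the following identity holds: (∂₁φ)·(∂₂φ̃) − (∂₂φ)·(∂₁φ̃) = λ · exp(2·λ·r(x)) · ( h(s x)·(deriv h̃)(s x) − (deriv h)(s x)·h̃(s x) ) · ( (∂₁r)·(∂₂s) − (∂₂r)·(∂₁s) ). -/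
/-- Directional derivative of `(h ∘ s) · exp (c r)`. -/
theorem fderiv_comp_mul_exp_apply {E : Type*} [NormedAddCommGroup E] [NormedSpace ℝ E]
    {r s : E → ℝ} {x : E} (hr : DifferentiableAt ℝ r x) (hs : DifferentiableAt ℝ s x)
    {h : ℝ → ℝ} (hh : DifferentiableAt ℝ h (s x)) (c : ℝ) (v : E) :
    fderiv ℝ (fun y => h (s y) * Real.exp (c * r y)) x v =
      Real.exp (c * r x) *
        (deriv h (s x) * fderiv ℝ s x v + c * h (s x) * fderiv ℝ r x v) := by
  have hcomp : HasFDerivAt (fun y => h (s y)) (deriv h (s x) • fderiv ℝ s x) x :=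
    hh.hasDerivAt.comp_hasFDerivAt x hs.hasFDerivAt
  rw [(hcomp.fun_mul (hr.hasFDerivAt.const_mul c).exp).fderiv]
  simp only [add_apply, smul_apply, smul_eq_mul]
  ring

/-- Gradient cross-product identity (Eq. (31)) for two eigenfunctions built
from the same time-of-flight `r` and parameterization `s` but different data
functions `h`, `ht`. -/
theorem gradient_cross_product_identity
    (r s : ℝ × ℝ → ℝ) (x : ℝ × ℝ)
    (hr : DifferentiableAt ℝ r x) (hs : DifferentiableAt ℝ s x)
    (h ht : ℝ → ℝ)
    (hh : DifferentiableAt ℝ h (s x)) (hht : DifferentiableAt ℝ ht (s x))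
    (lam : ℝ)
    (φ φt : ℝ × ℝ → ℝ)
    (hφ : φ = fun y => h (s y) * Real.exp (lam * r y))
    (hφt : φt = fun y => ht (s y) * Real.exp (lam * r y)) :
    fderiv ℝ φ x (1, 0) * fderiv ℝ φt x (0, 1)
        - fderiv ℝ φ x (0, 1) * fderiv ℝ φt x (1, 0) =
      lam * Real.exp (2 * lam * r x)
        * (h (s x) * deriv ht (s x) - deriv h (s x) * ht (s x))
        * (fderiv ℝ r x (1, 0) * fderiv ℝ s x (0, 1)
            - fderiv ℝ r x (0, 1) * fderiv ℝ s x (1, 0)) := by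
  subst hφ hφt
  have hexp : Real.exp (2 * lam * r x) = Real.exp (lam * r x) * Real.exp (lam * r x) := by
    rw [← Real.exp_add]
    ring_nf
  simp only [fderiv_comp_mul_exp_apply hr hs hh, fderiv_comp_mul_exp_apply hr hs hht, hexp]
  ring
end

section
/- Let a₁, a₂, λ ∈ ℝ with a₂ ≠ 0, and let h : ℝ → ℝ be a differentiable function. Fix a point (x₁, x₂) ∈ ℝ × ℝ with x₂ > 0, and suppose h is differentiable at x₁ · x₂^{−a₁/a₂}. Then the function φ : ℝ × ℝ → ℝ defined for y₂ > 0 by φ(y₁, y₂) = y₂^{λ/a₂} · h( y₁ · y₂^{−a₁/a₂} ) (real powers, Real.rpow) is differentiable at (x₁, x₂) and satisfies the Koopman generator PDE of the linear system ẋ₁ = a₁x₁, ẋ₂ = a₂x₂ there: a₁·x₁ · (fderiv ℝ φ (x₁,x₂) (1,0)) + a₂·x₂ · (fderiv ℝ φ (x₁,x₂) (0,1)) = λ · φ(x₁, x₂). -/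
/-- Eq. (46): the method-of-characteristics solution
`φ(y₁,y₂) = y₂^{λ/a₂} h(y₁ y₂^{-a₁/a₂})` satisfies the Koopman generator PDE
of the linear system `ẋ₁ = a₁x₁, ẋ₂ = a₂x₂` at any point with `x₂ > 0`. -/
theorem linear_system_characteristics_eigenfunction
    (a₁ a₂ lam : ℝ) (ha₂ : a₂ ≠ 0)
    (h : ℝ → ℝ) (hdiff : Differentiable ℝ h)
    (x₁ x₂ : ℝ) (hx₂ : 0 < x₂)
    (hhd : DifferentiableAt ℝ h (x₁ * x₂ ^ (-(a₁ / a₂)))) :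
    DifferentiableAt ℝ
        (fun y : ℝ × ℝ => y.2 ^ (lam / a₂) * h (y.1 * y.2 ^ (-(a₁ / a₂)))) (x₁, x₂) ∧
      a₁ * x₁ *
          fderiv ℝ (fun y : ℝ × ℝ => y.2 ^ (lam / a₂) * h (y.1 * y.2 ^ (-(a₁ / a₂))))
            (x₁, x₂) (1, 0) +
        a₂ * x₂ *
          fderiv ℝ (fun y : ℝ × ℝ => y.2 ^ (lam / a₂) * h (y.1 * y.2 ^ (-(a₁ / a₂))))
            (x₁, x₂) (0, 1) =
        lam * (x₂ ^ (lam / a₂) * h (x₁ * x₂ ^ (-(a₁ / a₂)))) := by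
  have hpow (p : ℝ) : HasFDerivAt (fun y : ℝ × ℝ => y.2 ^ p)
      ((p * (x₂ ^ p / x₂)) • ContinuousLinearMap.snd ℝ ℝ ℝ) (x₁, x₂) := by
    have hsnd : HasFDerivAt (fun y : ℝ × ℝ => y.2) (ContinuousLinearMap.snd ℝ ℝ ℝ) (x₁, x₂) :=
      hasFDerivAt_snd
    simpa [Real.rpow_sub_one hx₂.ne'] using hsnd.rpow_const (p := p) (Or.inl hx₂.ne')
  have hfst : HasFDerivAt (fun y : ℝ × ℝ => y.1) (ContinuousLinearMap.fst ℝ ℝ ℝ) (x₁, x₂) :=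
    hasFDerivAt_fst
  have hφ := (hpow (lam / a₂)).fun_mul <|
    hhd.hasDerivAt.comp_hasFDerivAt_of_eq (x₁, x₂) (hfst.fun_mul (hpow (-(a₁ / a₂)))) rfl
  refine ⟨hφ.differentiableAt, ?_⟩
  rw [HasFDerivAt.fderiv (f := fun y : ℝ × ℝ => y.2 ^ (lam / a₂) * h (y.1 * y.2 ^ (-(a₁ / a₂)))) hφ]
  simp only [Function.comp_apply, add_apply, smul_apply,
    ContinuousLinearMap.coe_fst', ContinuousLinearMap.coe_snd', smul_eq_mul]
  field_simp
  ring
end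

section
/- Let ω ∈ ℝ with ω ≠ 0, and let f : ℝ × AddCircle(2π) → ℂ satisfy, for every t ∈ ℝ, every I ∈ ℝ, and every θ ∈ AddCircle(2π), the eigenfunction equation f(I, θ + ↑(t·I)) = exp(i·ω·t) · f(I, θ). Then for every I ∈ ℝ and θ ∈ AddCircle(2π), if f(I, θ) ≠ 0 then there exists an integer k with ω = k · I. In other words, f vanishes identically off the countable family of circles { I = ω/k : k ∈ ℤ, k ≠ 0 }. -/
/-- Appendix C.2: any pointwise eigenfunction of the twist flow with
eigenvalue `e^{iωt}` (ω ≠ 0) vanishes off the resonant circles `I = ω/k`. -/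
theorem twist_flow_eigenfunction_supported_on_resonant_circles
    (ω : ℝ) (hω : ω ≠ 0)
    (f : ℝ × AddCircle (2 * Real.pi) → ℂ)
    (heig : ∀ (t a : ℝ) (θ : AddCircle (2 * Real.pi)),
      f (a, θ + (↑(t * a) : AddCircle (2 * Real.pi)))
        = Complex.exp (Complex.I * ω * t) * f (a, θ)) :
    ∀ (a : ℝ) (θ : AddCircle (2 * Real.pi)),
      f (a, θ) ≠ 0 → ∃ k : ℤ, ω = k * a := by
  intro a θ hf
  have exp_eq_one (t : ℝ) (ht : (↑(t * a) : AddCircle (2 * Real.pi)) = 0) :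
      Complex.exp (Complex.I * ω * t) = 1 := by
    have h := heig t a θ
    rw [ht, add_zero] at h
    exact mul_right_cancel₀ hf (by rw [one_mul, ← h])
  rcases eq_or_ne a 0 with rfl | ha
  · have h := exp_eq_one (Real.pi / ω) (by simp)
    have hωC : (ω : ℂ) ≠ 0 := by exact_mod_cast hω
    have harg : Complex.I * ω * ((Real.pi / ω : ℝ) : ℂ) = Real.pi * Complex.I := by
      push_cast
      field_simp
    rw [harg, Complex.exp_pi_mul_I] at h
    norm_num at h
  · have h := exp_eq_one (2 * Real.pi / a) (by
      rw [div_mul_cancel₀ _ ha]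
      exact AddCircle.coe_period _)
    obtain ⟨n, hn⟩ := Complex.exp_eq_one_iff.mp h
    refine ⟨n, ?_⟩
    have him : ω * (2 * Real.pi / a) = n * (2 * Real.pi) := by
      have := congrArg Complex.im hn
      simpa [mul_assoc, ← Complex.ofReal_ofNat, ← Complex.ofReal_mul,
        ← Complex.ofReal_div] using this
    have hpi := Real.pi_ne_zero
    field_simp at him
    linarith
end

section
/- Let ω ∈ ℝ with ω ≠ 0, and let f : ℝ × AddCircle(2π) → ℂ satisfy, for every t ∈ ℝ, every I ∈ ℝ, and every θ ∈ AddCircle(2π), the eigenfunction equation f(I, θ + ↑(t·I)) = exp(i·ω·t) · f(I, θ). Then f = 0 almost everywhere with respect to the product of Lebesgue measure on ℝ and Haar measure on AddCircle(2π). Hence the Koopman composition operator of the twist flow on L²(ℝ × AddCircle(2π)) has no nonzero eigenfunction with eigenvalue e^{iωt} for ω ≠ 0, and its point spectrum restricted to such values is empty. -/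
open MeasureTheory

instance : Fact (0 < 2 * Real.pi) := ⟨by positivity⟩

/-- Away from the resonant actions `ω / n` (with `0 = ω / 0` included), every solution of the
eigenfunction equation of the twist flow vanishes: the orbit of `(a, θ)` closes up at time
`2π / a`, while the multiplier there is not `1`. -/
theorem twist_eigenfunction_eq_zero_of_nonresonant {ω : ℝ} (hω : ω ≠ 0)
    {f : ℝ × AddCircle (2 * Real.pi) → ℂ}
    (heig : ∀ (t a : ℝ) (θ : AddCircle (2 * Real.pi)),
      f (a, θ + (↑(t * a) : AddCircle (2 * Real.pi)))
        = Complex.exp (Complex.I * ω * t) * f (a, θ))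
    {a : ℝ} (ha : a ∉ Set.range fun n : ℤ => ω / n) (θ : AddCircle (2 * Real.pi)) :
    f (a, θ) = 0 := by
  have ha0 : a ≠ 0 := fun h => ha ⟨0, by simp [h]⟩
  by_contra hf
  have h := heig (2 * Real.pi / a) a θ
  rw [div_mul_cancel₀ _ ha0, AddCircle.coe_period, add_zero] at h
  obtain ⟨n, hn⟩ := Complex.exp_eq_one_iff.mp (mul_eq_right₀ hf |>.mp h.symm)
  have hωn : ω = a * n := by
    have haC : (a : ℂ) ≠ 0 := by exact_mod_cast ha0
    push_cast at hn
    field_simp at hn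
    exact_mod_cast hn
  rcases eq_or_ne n 0 with rfl | hn0
  · exact hω (by simpa using hωn)
  · exact ha ⟨n, by rw [hωn]; field_simp⟩

/-- Appendix C.2: a pointwise eigenfunction of the twist flow with eigenvalue
`e^{iωt}`, `ω ≠ 0`, vanishes almost everywhere; the point spectrum of the
Koopman operator on the full (recurrent) cylinder is empty at such values. -/
theorem twist_flow_no_nonzero_eigenfunction
    (ω : ℝ) (hω : ω ≠ 0)
    (f : ℝ × AddCircle (2 * Real.pi) → ℂ)
    (heig : ∀ (t a : ℝ) (θ : AddCircle (2 * Real.pi)),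
      f (a, θ + (↑(t * a) : AddCircle (2 * Real.pi)))
        = Complex.exp (Complex.I * ω * t) * f (a, θ)) :
    ∀ᵐ p : ℝ × AddCircle (2 * Real.pi) ∂volume, f p = 0 := by
  have hae : ∀ᵐ a : ℝ, a ∉ Set.range fun n : ℤ => ω / n :=
    (Set.countable_range _).ae_notMem volume
  filter_upwards [Measure.quasiMeasurePreserving_fst.ae hae] with p hp
  exact twist_eigenfunction_eq_zero_of_nonresonant hω heig hp p.2
end

section
/- Let λ, α ∈ ℂ and let h : ℝ → ℂ be any function. Define φ : ℝ × ℝ → ℂ by φ(I, θ) = h(I) · exp( λ · (↑θ − α) / ↑I ). Then for every I ∈ ℝ with I ≠ 0 and every θ ∈ ℝ, the function θ′ ↦ φ(I, θ′) is differentiable at θ and satisfies ↑I · deriv (fun θ′ => φ (I, θ′)) θ = λ · φ(I, θ). That is, φ solves the Koopman generator PDE İ ∂φ/∂I + I ∂φ/∂θ = λ φ of the action-angle vector field F(I, θ) = (0, I) away from I = 0; in particular every λ ∈ ℂ admits an eigenfunction on any wedge domain with I ≠ 0. -/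
/-- Appendix C.1: on a wedge domain away from `I = 0`, for every `λ ∈ ℂ` and
any data function `h`, `φ(I,θ) = h(I) e^{λ(θ−α)/I}` solves the Koopman
generator PDE `I ∂φ/∂θ = λ φ` of the action-angle field `F(I,θ) = (0, I)`. -/
theorem action_angle_wedge_eigenfunction
    (lam α : ℂ) (h : ℝ → ℂ) :
    ∀ a : ℝ, a ≠ 0 → ∀ θ : ℝ,
      DifferentiableAt ℝ
          (fun θ' : ℝ => h a * Complex.exp (lam * ((θ' : ℂ) - α) / (a : ℂ))) θ ∧
        (a : ℂ) * deriv (fun θ' : ℝ => h a * Complex.exp (lam * ((θ' : ℂ) - α) / (a : ℂ))) θ =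
          lam * (h a * Complex.exp (lam * ((θ : ℂ) - α) / (a : ℂ))) := by
  intro a ha θ
  have haC : (a : ℂ) ≠ 0 := Complex.ofReal_ne_zero.mpr ha
  have hexp : HasDerivAt
      (fun θ' : ℝ => h a * Complex.exp (lam * ((θ' : ℂ) - α) / (a : ℂ)))
      (h a * (Complex.exp (lam * ((θ : ℂ) - α) / (a : ℂ)) * (lam * 1 / (a : ℂ)))) θ :=
    ((((Complex.ofRealCLM.hasDerivAt (x := θ)).sub_const α).const_mul lam).div_const
      (a : ℂ)).cexp.const_mul (h a)
  refine ⟨hexp.differentiableAt, ?_⟩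
  rw [hexp.deriv]
  field_simp
end
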